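/- arXiv:0806.4899 — 9 statements merged into one kernel-verified Lean document; each statement's English description precedes it below -/
import Mathlib

section
/- Let n ≥ 2, let p_1 ≤ p_2 ≤ ... ≤ p_n be strictly positive real numbers, and let D be a positive integer with 2^D ≥ n. Then H(D, n−1) equals the minimum, over all prefix-free codes w of size n over the two-letter alphabet {0,1} satisfying |w_i| ≤ D for all i, of the cost sum_{i=1}^n p_i·|w_i| (the equality being between elements of [0,∞]). -/
open scoped ENNReal

/-- Prefix sum `S_m = p_1 + ... + p_m`, viewed in `[0,∞]`. -/
noncomputable def prefSum (p : ℕ → ℝ) (m : ℕ) : ℝ≥0∞ :=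
  ENNReal.ofReal (∑ i ∈ Finset.Icc 1 m, p i)

/-- The cost family `c_{i,j}` of the binary length-limited Huffman DP:
`c_{0,0} = 0`, `c_{i,j} = S_{2i-j}` if `max(0, 2i-n) ≤ j < i`, and `∞` otherwise. -/
noncomputable def cBin (n : ℕ) (p : ℕ → ℝ) (i j : ℕ) : ℝ≥0∞ :=
  if i = 0 ∧ j = 0 then 0
  else if 2 * i - n ≤ j ∧ j < i then prefSum p (2 * i - j)
  else ⊤

/-- The DP: `H(0,0)=0`, `H(0,i)=∞` for `i>0`, and
`H(d,i) = min_{0 ≤ j ≤ i} (H(d-1,j) + c_{i,j})`. -/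
noncomputable def dpH (n : ℕ) (p : ℕ → ℝ) : ℕ → ℕ → ℝ≥0∞
  | 0, i => if i = 0 then 0 else ⊤
  | d + 1, i => (Finset.range (i + 1)).inf fun j => dpH n p d j + cBin n p i j

section Aux

open Finset

theorem prefSum_eq (n : ℕ) (p : ℕ → ℝ) (hpos : ∀ i, 1 ≤ i → i ≤ n → 0 < p i) (m : ℕ) (hm : m ≤ n) :
    prefSum p m = ∑ i ∈ Icc 1 m, ENNReal.ofReal (p i) := by
  unfold prefSum
  rw [ENNReal.ofReal_sum_of_nonneg]
  intro i hi
  rw [mem_Icc] at hi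
  exact (hpos i hi.1 (hi.2.trans hm)).le

/-- words of length m -/
def wordsLen (m : ℕ) : Finset (List Bool) := univ.image (fun f : Fin m → Bool => List.ofFn f)

theorem mem_wordsLen (m : ℕ) (x : List Bool) : x ∈ wordsLen m ↔ x.length = m := by
  unfold wordsLen
  simp only [mem_image, mem_univ, true_and]
  constructor
  · rintro ⟨f, rfl⟩; simp
  · rintro rfl; exact ⟨x.get, List.ofFn_get x⟩

theorem card_wordsLen (m : ℕ) : (wordsLen m).card = 2 ^ m := by
  unfold wordsLen
  rw [card_image_of_injective _ List.ofFn_injective]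
  simp

def extSet (u : List Bool) (m : ℕ) : Finset (List Bool) := (wordsLen (m - u.length)).image (u ++ ·)

theorem card_extSet (u : List Bool) (m : ℕ) : (extSet u m).card = 2 ^ (m - u.length) := by
  unfold extSet
  rw [card_image_of_injective _ (List.append_right_injective u), card_wordsLen]

theorem mem_extSet (u : List Bool) (m : ℕ) (h : u.length ≤ m) (x : List Bool) :
    x ∈ extSet u m ↔ u <+: x ∧ x.length = m := by
  unfold extSet
  simp only [mem_image, mem_wordsLen]
  constructor
  · rintro ⟨v, hv, rfl⟩
    exact ⟨List.prefix_append _ _, by simp; omega⟩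
  · rintro ⟨⟨v, rfl⟩, hx⟩
    exact ⟨v, by simp at hx; omega, rfl⟩

theorem kraft_nat (s : Finset ℕ) (w : ℕ → List Bool) (D : ℕ)
    (hp : ∀ i ∈ s, ∀ j ∈ s, i ≠ j → ¬ w i <+: w j) (hD : ∀ i ∈ s, (w i).length ≤ D) :
    ∑ i ∈ s, 2 ^ (D - (w i).length) ≤ 2 ^ D := by
  have h1 : (s.biUnion (fun i => extSet (w i) D)).card = ∑ i ∈ s, 2 ^ (D - (w i).length) := by
    rw [card_biUnion]
    · exact sum_congr rfl fun i _ => card_extSet _ _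
    · intro i hi j hj hij
      show Disjoint (extSet (w i) D) (extSet (w j) D)
      rw [Finset.disjoint_left]
      intro x hx hx'
      rw [mem_extSet _ _ (hD _ hi)] at hx
      rw [mem_extSet _ _ (hD _ hj)] at hx'
      rcases List.prefix_or_prefix_of_prefix hx.1 hx'.1 with h | h
      · exact hp i hi j hj hij h
      · exact hp j hj i hi hij.symm h
  rw [← h1, ← card_wordsLen]
  apply card_le_card
  intro x hx
  rw [mem_biUnion] at hx
  obtain ⟨i, hi, hx⟩ := hx
  rw [mem_extSet _ _ (hD _ hi)] at hx
  rw [mem_wordsLen]; exact hx.2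

theorem kraft_conv (l : ℕ → ℕ) (hl : Monotone l) (D : ℕ) (hD : ∀ i, l i ≤ D) (k : ℕ)
    (hk : ∑ i ∈ range k, 2 ^ (D - l i) ≤ 2 ^ D) :
    ∃ w : ℕ → List Bool, (∀ i < k, (w i).length = l i) ∧
      ∀ i < k, ∀ j < k, i ≠ j → ¬ w i <+: w j := by
  induction k with
  | zero => exact ⟨fun _ => [], by simp, by simp⟩
  | succ k ih =>
    rw [sum_range_succ] at hk
    obtain ⟨w, hw1, hw2⟩ := ih (le_trans (Nat.le_add_right _ _) hk)
    have hlt : ∑ i ∈ range k, 2 ^ (l k - l i) < 2 ^ l k := by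
      have h2 : ∑ i ∈ range k, 2 ^ (D - l i) = 2 ^ (D - l k) * ∑ i ∈ range k, 2 ^ (l k - l i) := by
        rw [mul_sum]
        apply sum_congr rfl
        intro i hi
        rw [← pow_add]
        have := hl (mem_range.1 hi).le
        have := hD k
        congr 1; omega
      have h3 : 2 ^ D = 2 ^ (D - l k) * 2 ^ l k := by
        rw [← pow_add]; have := hD k; congr 1; omega
      have h4 : 0 < 2 ^ (D - l k) := by positivity
      rw [h2, h3] at hk
      by_contra hcon
      push Not at hcon
      have := Nat.mul_le_mul_left (2 ^ (D - l k)) hcon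
      omega
    have hex : ∃ x ∈ wordsLen (l k), x ∉ (range k).biUnion (fun i => extSet (w i) (l k)) := by
      apply exists_mem_notMem_of_card_lt_card
      rw [card_wordsLen]
      refine lt_of_le_of_lt card_biUnion_le (lt_of_eq_of_lt ?_ hlt)
      apply sum_congr rfl
      intro i hi
      rw [card_extSet, hw1 i (mem_range.1 hi)]
    obtain ⟨x, hx, hx'⟩ := hex
    rw [mem_wordsLen] at hx
    have hnp : ∀ i < k, ¬ w i <+: x := by
      intro i hi hpre
      apply hx'
      rw [mem_biUnion]
      refine ⟨i, mem_range.2 hi, ?_⟩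
      rw [mem_extSet]
      · exact ⟨hpre, hx⟩
      · rw [hw1 i hi]; exact hl hi.le
    have hnp' : ∀ i < k, ¬ x <+: w i := by
      intro i hi hpre
      have h1 := hpre.length_le
      rw [hx, hw1 i hi] at h1
      have := hpre.eq_of_length_le (by rw [hx, hw1 i hi]; exact hl hi.le)
      exact hnp i hi (by rw [this])
    refine ⟨fun i => if i = k then x else w i, ?_, ?_⟩
    · intro i hi
      by_cases h : i = k
      · simp [h, hx]
      · simp only [h, if_false]; exact hw1 i (by omega)
    · intro i hi j hj hij
      by_cases h : i = k
      · have hjk : j ≠ k := by omega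
        simp only [h, hjk, if_true, if_false]
        exact hnp' j (by omega)
      · by_cases h' : j = k
        · simp only [h, h', if_true, if_false]
          exact hnp i (by omega)
        · simp only [h, h', if_false]
          exact hw2 i (by omega) j (by omega) hij

theorem subset_pow_sum (D : ℕ) : ∀ T : Finset ℕ, T ⊆ range D →
    ∑ s ∈ T, 2 ^ s + 2 ^ (D - T.card) ≤ 2 ^ D := by
  induction D with
  | zero =>
    intro T hT
    have : T = ∅ := by simpa using hT
    subst this; simp
  | succ D ih =>
    intro T hT
    by_cases h : D ∈ T
    · have h1 := ih (T.erase D) (by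
        intro x hx
        rw [mem_erase] at hx
        have := mem_range.1 (hT hx.2)
        rw [mem_range]; omega)
      have h2 := add_sum_erase T (fun s => 2 ^ s) h
      have h3 := card_erase_add_one h
      rw [← h2, ← h3, pow_succ]
      simp only [Nat.add_sub_add_right]
      omega
    · have hs : T ⊆ range D := by
        intro x hx
        have := mem_range.1 (hT hx)
        have : x ≠ D := fun e => h (e ▸ hx)
        rw [mem_range]; omega
      have h1 := ih T hs
      have h2 := card_le_card hs
      rw [card_range] at h2
      have h3 : D + 1 - T.card = (D - T.card) + 1 := by omega
      have h4 : 2 ^ (D - T.card) ≤ 2 ^ D := Nat.pow_le_pow_right (by norm_num) (by omega)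
      rw [h3, pow_succ, pow_succ]
      omega

theorem prefSum_le_subset (n : ℕ) (p : ℕ → ℝ) 
    (hmono : ∀ i j, 1 ≤ i → i ≤ j → j ≤ n → p i ≤ p j) (k : ℕ) :
    ∀ T : Finset ℕ, T.card = k → T ⊆ Icc 1 n →
     ∑ i ∈ Icc 1 k, ENNReal.ofReal (p i) ≤ ∑ i ∈ T, ENNReal.ofReal (p i) := by
  induction k with
  | zero => intro T _ _; simp
  | succ k ih =>
    intro T hT hs
    have hne : T.Nonempty := by rw [← card_pos]; omega
    have hm := T.max'_mem hne
    set m := T.max' hne with hmdef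
    have h1 := ih (T.erase m) (by rw [card_erase_of_mem hm]; omega) ((erase_subset _ _).trans hs)
    have hkm : k + 1 ≤ m := by
      have : T ⊆ Icc 1 m := by
        intro x hx
        have := T.le_max' x hx
        have := mem_Icc.1 (hs hx)
        rw [mem_Icc]; omega
      have := card_le_card this
      simp at this; omega
    rw [sum_Icc_succ_top (by omega), ← sum_erase_add T _ hm]
    gcongr
    exact hmono _ _ (by omega) hkm (mem_Icc.1 (hs hm)).2

theorem dpH_succ_le (n : ℕ) (p : ℕ → ℝ) (d : ℕ) : ∀ i, dpH n p (d+1) i ≤ dpH n p d i := by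
  induction d with
  | zero =>
    intro i
    by_cases h : i = 0
    · subst h; simp [dpH, cBin]
    · simp [dpH, h]
  | succ d ih =>
    intro i
    rw [dpH, dpH]
    apply Finset.inf_mono_fun
    intro j _
    gcongr
    exact ih j

def Jseq (L : ℕ → ℕ) : ℕ → ℕ
  | 0 => 0
  | t + 1 => (L t + Jseq L t) / 2

theorem Jseq_le (L : ℕ → ℕ) (hL : Monotone L) (t : ℕ) : Jseq L t ≤ L t := by
  induction t with
  | zero => simp [Jseq]
  | succ t ih =>
    have := hL (Nat.le_succ t)
    simp only [Jseq, Nat.succ_eq_add_one] at *; omega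

theorem Jseq_bounds (L : ℕ → ℕ) (t : ℕ) :
    2 ^ t * Jseq L t ≤ ∑ s ∈ range t, 2 ^ s * L s ∧
    ∑ s ∈ range t, 2 ^ s * L s < 2 ^ t * (Jseq L t + 1) := by
  induction t with
  | zero => simp [Jseq]
  | succ t ih =>
    rw [sum_range_succ]
    have h1 : 2 * Jseq L (t+1) ≤ L t + Jseq L t := by simp only [Jseq]; omega
    have h2 : L t + Jseq L t + 1 ≤ 2 * (Jseq L (t+1) + 1) := by simp only [Jseq]; omega
    have h3 := Nat.mul_le_mul_left (2 ^ t) h1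
    have h4 := Nat.mul_le_mul_left (2 ^ t) h2
    rw [pow_succ]
    constructor <;> nlinarith

theorem dpH_le_Jseq (n : ℕ) (p : ℕ → ℝ) (hpos : ∀ i, 1 ≤ i → i ≤ n → 0 < p i)
    (L : ℕ → ℕ) (hL : Monotone L) (hLn : ∀ s, L s ≤ n) (t : ℕ) :
    dpH n p t (Jseq L t) ≤ ∑ s ∈ range t, prefSum p (L s) := by
  induction t with
  | zero => simp [dpH, Jseq]
  | succ t ih =>
    rw [sum_range_succ]
    have hle := Jseq_le L hL t
    have h1 : 2 * Jseq L (t+1) ≤ L t + Jseq L t := by simp only [Jseq]; omega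
    have h2 : Jseq L t ≤ Jseq L (t+1) := by simp only [Jseq]; omega
    rcases h2.eq_or_lt with h | h
    · rw [← h]
      exact (dpH_succ_le n p t _).trans (ih.trans le_self_add)
    · rw [dpH]
      refine (Finset.inf_le (b := Jseq L t) (mem_range.2 (by omega))).trans ?_
      refine add_le_add ih ?_
      have hl := hLn t
      rw [cBin, if_neg (by omega), if_pos (by omega), prefSum_eq n p hpos _ (by omega),
        prefSum_eq n p hpos _ hl]
      apply sum_le_sum_of_subset
      exact Icc_subset_Icc le_rfl (by omega)

theorem dpH_path (n : ℕ) (p : ℕ → ℝ) (d : ℕ) : ∀ i, dpH n p d i ≠ ⊤ →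
    ∃ L : ℕ → ℕ, (∀ s, L s ≤ n) ∧ ∑ s ∈ range d, 2 ^ s * L s = 2 ^ d * i ∧
      ∑ s ∈ range d, prefSum p (L s) = dpH n p d i := by
  induction d with
  | zero =>
    intro i h
    have : i = 0 := by
      by_contra hc
      simp [dpH, hc] at h
    subst this
    exact ⟨fun _ => 0, by simp, by simp, by simp [dpH]⟩
  | succ d ih =>
    intro i h
    obtain ⟨j, hj, hjeq⟩ := Finset.exists_mem_eq_inf (range (i+1)) ⟨0, by simp⟩
      (fun j => dpH n p d j + cBin n p i j)
    have heq : dpH n p (d+1) i = dpH n p d j + cBin n p i j := by rw [dpH]; exact hjeq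
    rw [heq] at h ⊢
    rw [ENNReal.add_ne_top] at h
    obtain ⟨L, hL1, hL2, hL3⟩ := ih j h.1
    have hc : ∃ m, m ≤ n ∧ m + j = 2 * i ∧ cBin n p i j = prefSum p m := by
      have h2 := h.2
      by_cases h0 : i = 0 ∧ j = 0
      · exact ⟨0, by omega, by omega, by simp [cBin, h0, prefSum]⟩
      · by_cases h3 : 2 * i - n ≤ j ∧ j < i
        · exact ⟨2 * i - j, by omega, by omega, by rw [cBin, if_neg h0, if_pos h3]⟩
        · rw [cBin, if_neg h0, if_neg h3] at h2
          exact absurd rfl h2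
    obtain ⟨m, hm1, hm2, hm3⟩ := hc
    refine ⟨fun s => if s = d then m else L s, ?_, ?_, ?_⟩
    · intro s
      dsimp only
      split_ifs
      · exact hm1
      · exact hL1 s
    · rw [sum_range_succ]
      have : ∑ s ∈ range d, 2 ^ s * (if s = d then m else L s) = ∑ s ∈ range d, 2 ^ s * L s :=
        sum_congr rfl fun s hs => by rw [if_neg (mem_range.1 hs).ne]
      rw [this, hL2]
      simp only [if_true]
      rw [← mul_add, add_comm, hm2, pow_succ]; ring
    · rw [sum_range_succ]
      have : ∑ s ∈ range d, prefSum p (if s = d then m else L s) = ∑ s ∈ range d, prefSum p (L s) :=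
        sum_congr rfl fun s hs => by rw [if_neg (mem_range.1 hs).ne]
      rw [this, hL3, hm3]
      simp only [if_true]

theorem dp_le_code (n : ℕ) (hn : 2 ≤ n) (p : ℕ → ℝ)
    (hpos : ∀ i, 1 ≤ i → i ≤ n → 0 < p i)
    (hmono : ∀ i j, 1 ≤ i → i ≤ j → j ≤ n → p i ≤ p j) (D : ℕ) (l : ℕ → ℕ)
    (hl : ∀ i ∈ Icc 1 n, l i ≤ D) (hk : ∑ i ∈ Icc 1 n, 2 ^ (D - l i) ≤ 2 ^ D) :
    dpH n p D (n - 1) ≤ ∑ i ∈ Icc 1 n, ENNReal.ofReal (p i) * (l i : ℝ≥0∞) := by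
  set L : ℕ → ℕ := fun s => ((Icc 1 n).filter (fun i => D ≤ l i + s)).card with hLdef
  have hLm : Monotone L := by
    intro a b hab
    apply card_le_card
    apply monotone_filter_right
    intro i _ (hi : D ≤ l i + a)
    show D ≤ l i + b
    omega
  have hLn : ∀ s, L s ≤ n := fun s => (card_filter_le _ _).trans (by simp)
  have hfil : ∀ i ∈ Icc 1 n, (range D).filter (fun s => D ≤ l i + s) = Ico (D - l i) D := by
    intro i hi
    ext s
    simp only [mem_filter, mem_range, mem_Ico]
    omega
  have hsum : ∑ s ∈ range D, 2 ^ s * L s + ∑ i ∈ Icc 1 n, 2 ^ (D - l i) = n * 2 ^ D := by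
    have h1 : ∑ s ∈ range D, 2 ^ s * L s
        = ∑ i ∈ Icc 1 n, ∑ s ∈ (range D).filter (fun s => D ≤ l i + s), 2 ^ s := by
      simp only [sum_filter]
      rw [sum_comm]
      apply sum_congr rfl
      intro s _
      rw [← sum_filter, sum_const, smul_eq_mul, mul_comm]
    rw [h1, ← sum_add_distrib]
    have h2 : ∀ i ∈ Icc 1 n, (∑ s ∈ (range D).filter (fun s => D ≤ l i + s), 2 ^ s)
        + 2 ^ (D - l i) = 2 ^ D := by
      intro i hi
      rw [hfil i hi]
      have h3 := sum_range_add_sum_Ico (fun s => 2 ^ s) (show D - l i ≤ D by omega)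
      have h4 : ∀ k, ∑ s ∈ range k, 2 ^ s + 1 = 2 ^ k := by
        intro k
        induction k with
        | zero => simp
        | succ k ih => rw [sum_range_succ, pow_succ]; omega
      have h5 := h4 D
      have h6 := h4 (D - l i)
      omega
    rw [sum_congr rfl h2]
    simp
  have hb := Jseq_bounds L D
  have hJ : Jseq L D = n - 1 := by
    have hpos2 : 0 < ∑ i ∈ Icc 1 n, 2 ^ (D - l i) := by
      apply sum_pos
      · intros; positivity
      · exact ⟨1, by simp; omega⟩
    have h1 : 2 ^ D * Jseq L D < 2 ^ D * n := by
      rw [mul_comm _ n]; omega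
    have h2 := Nat.lt_of_mul_lt_mul_left h1
    have h3 : 2 ^ D * n < 2 ^ D * (Jseq L D + 2) := by
      rw [mul_comm _ n]; rw [mul_add] at *; omega
    have h4 := Nat.lt_of_mul_lt_mul_left h3
    omega
  rw [← hJ]
  refine (dpH_le_Jseq n p hpos L hLm hLn D).trans ?_
  calc ∑ s ∈ range D, prefSum p (L s)
      ≤ ∑ s ∈ range D, ∑ i ∈ (Icc 1 n).filter (fun i => D ≤ l i + s), ENNReal.ofReal (p i) := by
        apply sum_le_sum
        intro s _
        rw [prefSum_eq n p hpos _ (hLn s)]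
        exact prefSum_le_subset n p hmono _ _ rfl (filter_subset _ _)
    _ = ∑ i ∈ Icc 1 n, ∑ s ∈ (range D).filter (fun s => D ≤ l i + s), ENNReal.ofReal (p i) := by
        simp only [sum_filter]
        rw [sum_comm]
    _ = _ := by
        apply sum_congr rfl
        intro i hi
        rw [hfil i hi, sum_const, Nat.card_Ico, nsmul_eq_mul, mul_comm]
        have := hl i hi
        congr 2
        omega

theorem code_of_dp (n : ℕ) (hn : 2 ≤ n) (p : ℕ → ℝ)
    (hpos : ∀ i, 1 ≤ i → i ≤ n → 0 < p i) (D : ℕ) (h : dpH n p D (n - 1) ≠ ⊤) :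
    ∃ w : ℕ → List Bool,
      ((∀ i ∈ Finset.Icc 1 n, ∀ j ∈ Finset.Icc 1 n, i ≠ j → ¬ w i <+: w j) ∧
             ∀ i ∈ Finset.Icc 1 n, (w i).length ≤ D) ∧
      ∑ i ∈ Icc 1 n, ENNReal.ofReal (p i) * ((w i).length : ℝ≥0∞) = dpH n p D (n - 1) := by
  obtain ⟨L, hL1, hL2, hL3⟩ := dpH_path n p D _ h
  set l : ℕ → ℕ := fun i => ((range D).filter (fun s => i ≤ L s)).card with hldef
  have hfil : ∀ s, (Icc 1 n).filter (fun i => i ≤ L s) = Icc 1 (L s) := by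
    intro s
    have := hL1 s
    ext i; simp only [mem_filter, mem_Icc]; omega
  have hlD : ∀ i, l i ≤ D := fun i => (card_filter_le _ _).trans (by simp)
  have hanti : Antitone l := by
    intro a b hab
    apply card_le_card
    apply monotone_filter_right
    intro s _ (hs : b ≤ L s)
    exact hab.trans hs
  have hkraft : ∑ i ∈ Icc 1 n, 2 ^ (D - l i) ≤ 2 ^ D := by
    have h1 : ∑ i ∈ Icc 1 n, (∑ s ∈ (range D).filter (fun s => i ≤ L s), 2 ^ s + 2 ^ (D - l i))
        ≤ ∑ i ∈ Icc 1 n, 2 ^ D :=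
      sum_le_sum fun i _ => subset_pow_sum D _ (filter_subset _ _)
    have h2 : ∑ i ∈ Icc 1 n, ∑ s ∈ (range D).filter (fun s => i ≤ L s), 2 ^ s
        = 2 ^ D * (n - 1) := by
      rw [← hL2]
      simp only [sum_filter]
      rw [sum_comm]
      apply sum_congr rfl
      intro s _
      rw [← sum_filter, hfil, sum_const]
      simp [mul_comm]
    rw [sum_add_distrib, h2] at h1
    simp only [sum_const, Nat.card_Icc, smul_eq_mul, Nat.add_sub_cancel] at h1
    have h3 : n * 2 ^ D = 2 ^ D * (n - 1) + 2 ^ D := by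
      obtain ⟨m, rfl⟩ : ∃ m, n = m + 1 := ⟨n - 1, by omega⟩
      simp; ring
    omega
  have hre : ∑ i ∈ range n, 2 ^ (D - l (n - i)) = ∑ i ∈ Icc 1 n, 2 ^ (D - l i) := by
    apply sum_nbij' (fun i => n - i) (fun i => n - i)
    · intro i hi; simp only [mem_range, mem_Icc] at *; omega
    · intro i hi; simp only [mem_range, mem_Icc] at *; omega
    · intro i hi; simp only [mem_range, mem_Icc] at *; omega
    · intro i hi; simp only [mem_range, mem_Icc] at *; omega
    · intro i hi; rfl
  obtain ⟨w, hw1, hw2⟩ := kraft_conv (fun i => l (n - i))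
    (fun a b hab => hanti (by omega)) D (fun i => hlD _) n (by rw [hre]; exact hkraft)
  have hlen : ∀ i ∈ Icc 1 n, (w (n - i)).length = l i := by
    intro i hi
    rw [mem_Icc] at hi
    rw [hw1 (n - i) (by omega)]
    congr 1; omega
  refine ⟨fun i => w (n - i), ⟨?_, ?_⟩, ?_⟩
  · intro i hi j hj hij
    rw [mem_Icc] at hi hj
    exact hw2 _ (by omega) _ (by omega) (by omega)
  · intro i hi
    rw [hlen i hi]; exact hlD i
  · rw [← hL3]
    have h1 : ∀ s ∈ range D, prefSum p (L s)
        = ∑ i ∈ (Icc 1 n).filter (fun i => i ≤ L s), ENNReal.ofReal (p i) := by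
      intro s _
      rw [prefSum_eq n p hpos _ (hL1 s), hfil]
    rw [sum_congr rfl h1]
    simp only [sum_filter]
    rw [sum_comm]
    apply sum_congr rfl
    intro i hi
    rw [hlen i hi, ← sum_filter, sum_const, nsmul_eq_mul, mul_comm]

end Aux

theorem stmt_0 (n : ℕ) (hn : 2 ≤ n) (p : ℕ → ℝ)
    (hpos : ∀ i, 1 ≤ i → i ≤ n → 0 < p i)
    (hmono : ∀ i j, 1 ≤ i → i ≤ j → j ≤ n → p i ≤ p j)
    (D : ℕ) (hD : 1 ≤ D) (hDn : n ≤ 2 ^ D) :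
    dpH n p D (n - 1) =
      ⨅ (w : ℕ → List Bool)
        (_ : (∀ i ∈ Finset.Icc 1 n, ∀ j ∈ Finset.Icc 1 n, i ≠ j → ¬ w i <+: w j) ∧
             ∀ i ∈ Finset.Icc 1 n, (w i).length ≤ D),
        ∑ i ∈ Finset.Icc 1 n, ENNReal.ofReal (p i) * ((w i).length : ℝ≥0∞) := by
  apply le_antisymm
  · refine le_iInf fun w => le_iInf fun hw => ?_
    exact dp_le_code n hn p hpos hmono D (fun i => (w i).length) hw.2
      (kraft_nat _ w D hw.1 hw.2)
  · by_cases h : dpH n p D (n - 1) = ⊤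
    · rw [h]; exact le_top
    · obtain ⟨w, hw, hc⟩ := code_of_dp n hn p hpos D h
      rw [← hc]
      exact iInf₂_le w hw
end

section
/- Let n ≥ 1 and let p_1 ≤ p_2 ≤ ... ≤ p_n be nonnegative real numbers. Then the family c_{i,j} defined from the prefix sums S_m satisfies the Monge property: c_{i,j} + c_{i+1,j+1} ≤ c_{i+1,j} + c_{i,j+1} for all 0 ≤ i, j ≤ n−2. -/
open scoped ENNReal

theorem stmt_2 (n : ℕ) (hn : 1 ≤ n) (p : ℕ → ℝ)
    (hnonneg : ∀ i, 1 ≤ i → i ≤ n → 0 ≤ p i)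
    (hmono : ∀ i j, 1 ≤ i → i ≤ j → j ≤ n → p i ≤ p j) :
    ∀ i j : ℕ, i ≤ n - 2 → j ≤ n - 2 →
      cBin n p i j + cBin n p (i + 1) (j + 1) ≤ cBin n p (i + 1) j + cBin n p i (j + 1) := by
  intro i j hi hj
  by_cases h1 : 2 * (i + 1) - n ≤ j ∧ j < i + 1
  swap
  · have : cBin n p (i + 1) j = ⊤ := by
      unfold cBin
      rw [if_neg (by omega), if_neg h1]
    rw [this]; simp
  by_cases h2 : 2 * i - n ≤ j + 1 ∧ j + 1 < i
  swap
  · have : cBin n p i (j + 1) = ⊤ := by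
      unfold cBin
      rw [if_neg (by omega), if_neg h2]
    rw [this]; simp
  obtain ⟨m, hm⟩ : ∃ m, 2 * i - j = m + 1 := ⟨2 * i - j - 1, by omega⟩
  have e1 : cBin n p i j = prefSum p (m + 1) := by
    unfold cBin
    rw [if_neg (by omega), if_pos (by omega), hm]
  have e2 : cBin n p (i + 1) (j + 1) = prefSum p (m + 2) := by
    unfold cBin
    rw [if_neg (by omega), if_pos (by omega)]
    congr 1; omega
  have e3 : cBin n p (i + 1) j = prefSum p (m + 3) := by
    unfold cBin
    rw [if_neg (by omega), if_pos (by omega)]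
    congr 1; omega
  have e4 : cBin n p i (j + 1) = prefSum p m := by
    unfold cBin
    rw [if_neg (by omega), if_pos (by omega)]
    congr 1; omega
  have hmn : m + 3 ≤ n := by omega
  have hS : ∀ k, k ≤ n → 0 ≤ ∑ i ∈ Finset.Icc 1 k, p i := by
    intro k hk
    apply Finset.sum_nonneg
    intro x hx
    rw [Finset.mem_Icc] at hx
    exact hnonneg x hx.1 (by omega)
  rw [e1, e2, e3, e4]
  unfold prefSum
  rw [← ENNReal.ofReal_add (hS _ (by omega)) (hS _ (by omega)),
    ← ENNReal.ofReal_add (hS _ (by omega)) (hS _ (by omega))]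
  apply ENNReal.ofReal_le_ofReal
  have hs : ∀ k, ∑ i ∈ Finset.Icc 1 (k + 1), p i = ∑ i ∈ Finset.Icc 1 k, p i + p (k + 1) :=
    fun k => Finset.sum_Icc_succ_top (by omega) p
  have a1 := hs m
  have a2 := hs (m + 1)
  have a3 := hs (m + 2)
  have := hmono (m + 1) (m + 3) (by omega) (by omega) hmn
  norm_num [add_assoc] at a1 a2 a3 this ⊢
  linarith
end

section
/- Let r ≥ 2, let N ≥ 2 with (r−1) dividing (N−1), and let p_1 ≤ p_2 ≤ ... ≤ p_N be nonnegative real numbers. Then the family c_{i,j} defined from the prefix sums S_m satisfies the Monge property: c_{i,j} + c_{i+1,j+1} ≤ c_{i+1,j} + c_{i,j+1} for all 0 ≤ i, j ≤ n−2, where n = (N−1)/(r−1) + 1. -/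
open scoped ENNReal

/-- The cost family `c_{i,j}` of the `r`-ary length-limited Huffman DP with `N` weights:
`c_{0,0} = 0`, `c_{i,j} = S_{ri-j}` if `max(0, ri-N) ≤ j < i`, and `∞` otherwise. -/
noncomputable def cAry (N r : ℕ) (p : ℕ → ℝ) (i j : ℕ) : ℝ≥0∞ :=
  if i = 0 ∧ j = 0 then 0
  else if r * i - N ≤ j ∧ j < i then prefSum p (r * i - j)
  else ⊤

theorem stmt_3 (N r : ℕ) (hr : 2 ≤ r) (hN : 2 ≤ N) (hdvd : (r - 1) ∣ (N - 1))
    (p : ℕ → ℝ)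
    (hnonneg : ∀ i, 1 ≤ i → i ≤ N → 0 ≤ p i)
    (hmono : ∀ i j, 1 ≤ i → i ≤ j → j ≤ N → p i ≤ p j) :
    ∀ i j : ℕ, i ≤ (N - 1) / (r - 1) + 1 - 2 → j ≤ (N - 1) / (r - 1) + 1 - 2 →
      cAry N r p i j + cAry N r p (i + 1) (j + 1) ≤
        cAry N r p (i + 1) j + cAry N r p i (j + 1) := by
  intro i j _ _
  by_cases h1 : r * (i + 1) - N ≤ j ∧ j < i + 1
  swap
  · have : cAry N r p (i + 1) j = ⊤ := by
      unfold cAry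
      rw [if_neg (by omega), if_neg h1]
    rw [this, top_add]; exact le_top
  by_cases h2 : r * i - N ≤ j + 1 ∧ j + 1 < i
  swap
  · have : cAry N r p i (j + 1) = ⊤ := by
      unfold cAry
      rw [if_neg (by omega), if_neg h2]
    rw [this, add_top]; exact le_top
  have e : r * (i + 1) = r * i + r := by ring
  have hi : 2 * i ≤ r * i := Nat.mul_le_mul_right i hr
  rw [e] at h1
  have key : ∀ a b, 0 < a → r * a - N ≤ b ∧ b < a → cAry N r p a b = prefSum p (r * a - b) := by
    intro a b ha hab
    unfold cAry
    rw [if_neg (by omega), if_pos hab]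
  rw [key i j (by omega) (by omega), key (i + 1) (j + 1) (by omega) (by rw [e]; omega),
    key (i + 1) j (by omega) (by rw [e]; omega), key i (j + 1) (by omega) h2, e]
  obtain ⟨m, hm⟩ : ∃ m, r * i = m + 1 + j := ⟨r * i - (j + 1), by omega⟩
  have a1 : r * i - j = m + 1 := by omega
  have a2 : r * i + r - (j + 1) = m + r := by omega
  have a3 : r * i + r - j = m + r + 1 := by omega
  have a4 : r * i - (j + 1) = m := by omega
  rw [a1, a2, a3, a4]
  have hb : m + r + 1 ≤ N := by omega
  have nn : ∀ k, k ≤ N → 0 ≤ ∑ i ∈ Finset.Icc 1 k, p i := by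
    intro k hk
    apply Finset.sum_nonneg
    intro x hx
    rw [Finset.mem_Icc] at hx
    exact hnonneg x hx.1 (by omega)
  unfold prefSum
  rw [← ENNReal.ofReal_add (nn _ (by omega)) (nn _ (by omega)),
    ← ENNReal.ofReal_add (nn _ (by omega)) (nn _ (by omega))]
  apply ENNReal.ofReal_le_ofReal
  rw [Finset.sum_Icc_succ_top (by omega : 1 ≤ m + 1),
    Finset.sum_Icc_succ_top (by omega : 1 ≤ m + r + 1)]
  have := hmono (m + 1) (m + r + 1) (by omega) (by omega) hb
  linarith
end

section
/- Let r ≥ 2, let N ≥ 2, and let p_1 ≤ p_2 ≤ ... ≤ p_N be strictly positive real numbers. Let I = (i_0, i_1, ..., i_h) be a valid (N,r)-sequence such that cost(I) ≤ cost(I') for every valid (N,r)-sequence I' = (i'_0, ..., i'_h) of the same length h with i'_h = i_h. Then for every k with 2 ≤ k ≤ h, one has r·(i_k − i_{k−1}) ≥ i_{k−1} − i_{k−2} (i.e., the sequence represents a forest of complete r-ary trees). -/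
open scoped ENNReal

/-- `I = (i_0, …, i_h)` is a valid `(N,r)`-sequence: there is `t ≤ h` with
`i_0 = ⋯ = i_t = 0` and `0 < i_{t+1} < ⋯ < i_h ≤ (N-1)/(r-1)`, and
`r·i_k − i_{k-1} ≤ N` for `1 ≤ k ≤ h`. -/
def ValidSeq (N r h : ℕ) (I : ℕ → ℕ) : Prop :=
  (∃ t ≤ h, (∀ k ≤ t, I k = 0) ∧ (∀ k, t ≤ k → k < h → I k < I (k + 1)) ∧
      I h ≤ (N - 1) / (r - 1)) ∧
  ∀ k, 1 ≤ k → k ≤ h → r * I k ≤ N + I (k - 1)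

/-- `cost(I) = ∑_{k=1}^h S_{r·i_k − i_{k-1}}`. -/
noncomputable def costSeq (r h : ℕ) (p : ℕ → ℝ) (I : ℕ → ℕ) : ℝ≥0∞ :=
  ∑ k ∈ Finset.Icc 1 h, prefSum p (r * I k - I (k - 1))

theorem aux_split (h m : ℕ) (hm : m + 2 ≤ h) (f : ℕ → ℝ≥0∞) :
    ∑ k ∈ Finset.Icc 1 h, f k =
      (f (m+1) + f (m+2)) + ∑ k ∈ ((Finset.Icc 1 h).erase (m+1)).erase (m+2), f k := by
  rw [← Finset.add_sum_erase (Finset.Icc 1 h) f (a := m+1) (by simp; omega),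
    ← Finset.add_sum_erase ((Finset.Icc 1 h).erase (m+1)) f (a := m+2) (by simp; omega), add_assoc]

theorem aux_pref (N : ℕ) (p : ℕ → ℝ)
    (hpos : ∀ i, 1 ≤ i → i ≤ N → 0 < p i) (a : ℕ) (ha : a ≤ N) :
    0 ≤ ∑ i ∈ Finset.Icc 1 a, p i := by
  apply Finset.sum_nonneg
  intro i hi
  rw [Finset.mem_Icc] at hi
  exact (hpos i hi.1 (by omega)).le

theorem aux_exch (N r : ℕ) (hr : 2 ≤ r) (p : ℕ → ℝ)
    (hpos : ∀ i, 1 ≤ i → i ≤ N → 0 < p i)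
    (hmono : ∀ i j, 1 ≤ i → i ≤ j → j ≤ N → p i ≤ p j)
    (a b : ℕ) (hb : b < a + r) (ha : a + r ≤ N) :
    prefSum p a + prefSum p (b+1) < prefSum p (a + r) + prefSum p b := by
  have P := aux_pref N p hpos
  unfold prefSum
  rw [← ENNReal.ofReal_add (P _ (by omega)) (P _ (by omega)),
    ← ENNReal.ofReal_add (P _ (by omega)) (P _ (by omega))]
  obtain ⟨s, rfl⟩ : ∃ s, r = s + 2 := ⟨r - 2, by omega⟩
  have h1 : ∑ i ∈ Finset.Icc 1 a, p i ≤ ∑ i ∈ Finset.Icc 1 (a + s), p i := by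
    apply Finset.sum_le_sum_of_subset_of_nonneg
    · exact Finset.Icc_subset_Icc_right (by omega)
    · intro i hi _
      rw [Finset.mem_Icc] at hi
      exact (hpos i hi.1 (by omega)).le
  have h2 := hmono (b+1) (a + (s+2)) (by omega) (by omega) ha
  have h3 := hpos (a + s + 1) (by omega) (by omega)
  have h4 := hpos (a + (s + 2)) (by omega) (by omega)
  have e : ∑ i ∈ Finset.Icc 1 (a + (s+2)), p i =
      ∑ i ∈ Finset.Icc 1 (a + s), p i + p (a + s + 1) + p (a + (s + 2)) := by
    rw [show a + (s+2) = a + s + 1 + 1 by ring, Finset.sum_Icc_succ_top (by omega),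
      Finset.sum_Icc_succ_top (by omega)]
  have e2 : ∑ i ∈ Finset.Icc 1 (b+1), p i = ∑ i ∈ Finset.Icc 1 b, p i + p (b+1) :=
    Finset.sum_Icc_succ_top (by omega) _
  have n1 := P b (by omega)
  have n2 := P a (by omega)
  rw [ENNReal.ofReal_lt_ofReal_iff (by linarith)]
  linarith

theorem stmt_7 (N r : ℕ) (hr : 2 ≤ r) (hN : 2 ≤ N)
    (p : ℕ → ℝ)
    (hpos : ∀ i, 1 ≤ i → i ≤ N → 0 < p i)
    (hmono : ∀ i j, 1 ≤ i → i ≤ j → j ≤ N → p i ≤ p j)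
    (h : ℕ) (I : ℕ → ℕ) (hI : ValidSeq N r h I)
    (hopt : ∀ I' : ℕ → ℕ, ValidSeq N r h I' → I' h = I h →
      costSeq r h p I ≤ costSeq r h p I') :
    ∀ k, 2 ≤ k → k ≤ h → I (k - 1) - I (k - 2) ≤ r * (I k - I (k - 1)) := by
  intro k hk2 hkh
  obtain ⟨m, rfl⟩ : ∃ m, k = m + 2 := ⟨k - 2, by omega⟩
  rw [show m + 2 - 1 = m + 1 by omega, show m + 2 - 2 = m by omega]
  by_contra hcon
  push Not at hcon
  obtain ⟨⟨t, hth, hz, hs, hle⟩, hc⟩ := hI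
  have htm : t ≤ m := by
    by_contra hlt
    have := hz (m+1) (by omega)
    rw [this] at hcon
    simp at hcon
  have s1 := hs m htm (by omega)
  have s2 : I (m+1) < I (m+2) := hs (m+1) (by omega) (by omega)
  have c1 : r * I (m+1) ≤ N + I m := hc (m+1) (by omega) (by omega)
  have c2 : r * I (m+2) ≤ N + I (m+1) := hc (m+2) (by omega) (by omega)
  obtain ⟨d, hd⟩ : ∃ d, I (m+1) = I m + d + 1 := ⟨I (m+1) - I m - 1, by omega⟩
  obtain ⟨e, he⟩ : ∃ e, I (m+2) = I (m+1) + e := ⟨I (m+2) - I (m+1), by omega⟩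
  have hcon' : r * e < d + 1 := by
    have x1 : I (m+2) - I (m+1) = e := by omega
    have x2 : I (m+1) - I m = d + 1 := by omega
    rwa [x1, x2] at hcon
  have hre : 2 ≤ r * e := by
    have : 1 ≤ e := by omega
    nlinarith
  have E2 : r * I (m+2) = r * I (m+1) + r * e := by rw [he]; ring
  have E1 : r * I (m+1) = r * (I m + d) + r := by rw [hd]; ring
  have G : I m + d ≤ r * (I m + d) := Nat.le_mul_of_pos_left _ (by omega)
  set I' : ℕ → ℕ := Function.update I (m+1) (I m + d) with hI'
  have u1 : I' (m+1) = I m + d := by simp [hI']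
  have u : ∀ j, j ≠ m+1 → I' j = I j := fun j hj => by simp [hI', hj]
  have u0 := u m (by omega)
  have u2 := u (m+2) (by omega)
  have uh := u h (by omega)
  have hv : ValidSeq N r h I' := by
    refine ⟨⟨t, hth, ?_, ?_, by rw [uh]; exact hle⟩, ?_⟩
    · intro j hj
      rw [u j (by omega)]
      exact hz j hj
    · intro j hj hjh
      by_cases h1 : j = m + 1
      · subst h1
        rw [u1, show m + 1 + 1 = m + 2 by omega, u2]
        omega
      · by_cases h2 : j = m
        · subst h2
          rw [u1, u0]; omega
        · rw [u j h1, u (j+1) (by omega)]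
          exact hs j hj hjh
    · intro j hj hjh
      by_cases h1 : j = m + 1
      · subst h1
        rw [u1, show m + 1 - 1 = m by omega, u0]
        omega
      · by_cases h2 : j = m + 2
        · subst h2
          rw [show m + 2 - 1 = m + 1 by omega, u1, u2]
          omega
        · rw [u j h1, u (j-1) (by omega)]
          exact hc j hj hjh
  have hfin := hopt I' hv uh
  unfold costSeq at hfin
  rw [aux_split h m hkh, aux_split h m hkh] at hfin
  have hrest : ∑ k ∈ ((Finset.Icc 1 h).erase (m+1)).erase (m+2), prefSum p (r * I' k - I' (k - 1))
      = ∑ k ∈ ((Finset.Icc 1 h).erase (m+1)).erase (m+2), prefSum p (r * I k - I (k - 1)) := by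
    apply Finset.sum_congr rfl
    intro j hj
    simp only [Finset.mem_erase, Finset.mem_Icc] at hj
    rw [u j (by omega), u (j-1) (by omega)]
  rw [hrest] at hfin
  have hne : ∑ k ∈ ((Finset.Icc 1 h).erase (m+1)).erase (m+2), prefSum p (r * I k - I (k - 1)) ≠ ⊤ := by
    rw [ENNReal.sum_ne_top]
    intro j _
    exact ENNReal.ofReal_ne_top
  have hfin' := (ENNReal.add_le_add_iff_right hne).1 hfin
  rw [show m + 1 - 1 = m by omega, show m + 2 - 1 = m + 1 by omega, u0, u1, u2] at hfin'
  have X := aux_exch N r hr p hpos hmono (r * (I m + d) - I m) (r * I (m+2) - I (m+1))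
    (by omega) (by omega)
  rw [show r * (I m + d) - I m + r = r * I (m+1) - I m by omega,
    show r * I (m+2) - I (m+1) + 1 = r * I (m+2) - (I m + d) by omega] at X
  exact absurd hfin' (not_le.2 X)
end

section
/- Let r ≥ 2, let N ≥ 2 with (r−1) dividing (N−1), and let p_1 ≤ p_2 ≤ ... ≤ p_N be strictly positive real numbers. Let I = (i_0, i_1, ..., i_h) be a valid (N,r)-sequence with i_h = (N−1)/(r−1) such that cost(I) ≤ cost(I') for every valid (N,r)-sequence I' of length h with last entry (N−1)/(r−1). Then there exists a prefix-free code w of size N over an alphabet with r letters such that |w_i| ≤ h for all i and sum_{i=1}^N p_i·|w_i| = cost(I). -/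
open scoped ENNReal

lemma kraft_aux (r : ℕ) (hr : 2 ≤ r) (h : ℕ) : ∀ K : Finset ℕ, K ⊆ Finset.range h →
    r ^ (h - K.card) + (r - 1) * ∑ k ∈ K, r ^ k ≤ r ^ h := by
  obtain ⟨q, rfl⟩ : ∃ q, r = q + 1 := ⟨r - 1, by omega⟩
  simp only [Nat.add_sub_cancel]
  induction h with
  | zero =>
    intro K hK
    have : K = ∅ := by simpa using hK
    subst this
    simp
  | succ h ih =>
    intro K hK
    by_cases hh : h ∈ K
    · have h1 : K.erase h ⊆ Finset.range h := by
        intro x hx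
        have := hK (Finset.mem_of_mem_erase hx)
        have := Finset.ne_of_mem_erase hx
        simp at *
        omega
      have h2 := ih _ h1
      rw [← Finset.add_sum_erase K _ hh]
      have h3 : K.card = (K.erase h).card + 1 := (Finset.card_erase_add_one hh).symm
      rw [h3, Nat.add_sub_add_right, pow_succ]
      nlinarith
    · have h1 : K ⊆ Finset.range h := by
        intro x hx
        have := hK hx
        have : x ≠ h := fun e => hh (e ▸ hx)
        simp at *
        omega
      have h2 := ih _ h1
      have h3 : K.card ≤ h := by simpa using Finset.card_le_card h1
      rw [Nat.succ_sub h3, pow_succ, pow_succ]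
      nlinarith [Nat.zero_le (q * (q * ∑ k ∈ K, (q + 1) ^ k))]

def codeWord (r : ℕ) (hr : 2 ≤ r) (h C l : ℕ) : List (Fin r) :=
  List.ofFn (fun t : Fin l => ⟨C / r ^ (h - 1 - t) % r, Nat.mod_lt _ (by omega)⟩)

lemma codeWord_prefix (r : ℕ) (hr : 2 ≤ r) (h C l C' l' : ℕ) (hl : l ≤ h)
    (hC : C < r ^ h) (hC' : C' < r ^ h)
    (hp : codeWord r hr h C l <+: codeWord r hr h C' l') :
    C / r ^ (h - l) = C' / r ^ (h - l) := by
  have hlen : l ≤ l' := by simpa [codeWord] using hp.length_le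
  have hd : ∀ t, t < l → C / r ^ (h - 1 - t) % r = C' / r ^ (h - 1 - t) % r := by
    intro t ht
    have := hp.getElem (i := t) (by simpa [codeWord] using ht)
    simpa [codeWord] using this
  have key : ∀ s, s ≤ l → C / r ^ (h - s) = C' / r ^ (h - s) := by
    intro s
    induction s with
    | zero => intro _; simp [Nat.div_eq_of_lt hC, Nat.div_eq_of_lt hC']
    | succ s ih =>
      intro hs
      have h1 := ih (by omega)
      have h2 := hd s (by omega)
      have e : h - s = (h - 1 - s) + 1 := by omega
      rw [e, pow_succ, ← Nat.div_div_eq_div_mul, ← Nat.div_div_eq_div_mul] at h1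
      have e2 : h - (s + 1) = h - 1 - s := by omega
      rw [e2, ← Nat.div_add_mod (C / r ^ (h - 1 - s)) r, h1, h2, Nat.div_add_mod]
  exact key l le_rfl

lemma kraft_code (N r : ℕ) (hr : 2 ≤ r) (h : ℕ) (l : ℕ → ℕ) (hl : ∀ i, l i ≤ h)
    (hmono : ∀ i j, i ≤ j → l j ≤ l i)
    (hk : ∑ i ∈ Finset.Icc 1 N, r ^ (h - l i) ≤ r ^ h) :
    ∃ w : ℕ → List (Fin r),
      (∀ i ∈ Finset.Icc 1 N, ∀ j ∈ Finset.Icc 1 N, i ≠ j → ¬ w i <+: w j) ∧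
      (∀ i, (w i).length = l i) := by
  let C : ℕ → ℕ := fun i => ∑ j ∈ Finset.Ioc i N, r ^ (h - l j)
  have hrp : ∀ m, 0 < r ^ m := fun m => pow_pos (by omega) m
  have hstep : ∀ i j, j < i → i ≤ N → C i + r ^ (h - l i) ≤ C j := by
    intro i j hji hi
    have hn : i ∉ Finset.Ioc i N := by simp
    have : insert i (Finset.Ioc i N) ⊆ Finset.Ioc j N := by
      intro x hx
      simp at *
      omega
    have h2 := Finset.sum_le_sum_of_subset (f := fun j => r ^ (h - l j)) this
    rw [Finset.sum_insert hn] at h2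
    simp only [C]
    omega
  have hC0 : C 0 ≤ r ^ h := hk
  have hCl : ∀ i, 1 ≤ i → i ≤ N → C i < r ^ h := by
    intro i h1 h2
    have := hstep i 0 h1 h2
    have := hrp (h - l i)
    omega
  have main : ∀ i j, 1 ≤ j → j < i → i ≤ N →
      ¬ codeWord r hr h (C i) (l i) <+: codeWord r hr h (C j) (l j) := by
    intro i j h1 h2 h3 hp
    have e := codeWord_prefix r hr h _ _ _ _ (hl i) (hCl i (by omega) h3) (hCl j h1 (by omega)) hp
    have h4 := Nat.div_le_div_right (c := r ^ (h - l i)) (hstep i j h2 h3)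
    rw [Nat.add_div_right _ (hrp _)] at h4
    omega
  refine ⟨fun i => codeWord r hr h (C i) (l i), ?_, fun i => by simp [codeWord]⟩
  intro i hi j hj hij hp
  simp only [Finset.mem_Icc] at hi hj
  rcases lt_or_gt_of_ne hij with hlt | hlt
  · have h1 : l i ≤ l j := by simpa [codeWord] using hp.length_le
    have h2 := hmono i j hlt.le
    have := hp.eq_of_length (by simp [codeWord]; omega)
    exact main j i hi.1 hlt hj.2 (by simp only at this; rw [this])
  · exact main i j hj.1 hlt hi.2 hp

theorem stmt_8 (N r : ℕ) (hr : 2 ≤ r) (hN : 2 ≤ N) (hdvd : (r - 1) ∣ (N - 1))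
    (p : ℕ → ℝ)
    (hpos : ∀ i, 1 ≤ i → i ≤ N → 0 < p i)
    (hmono : ∀ i j, 1 ≤ i → i ≤ j → j ≤ N → p i ≤ p j)
    (h : ℕ) (I : ℕ → ℕ) (hI : ValidSeq N r h I) (hlast : I h = (N - 1) / (r - 1))
    (hopt : ∀ I' : ℕ → ℕ, ValidSeq N r h I' → I' h = (N - 1) / (r - 1) →
      costSeq r h p I ≤ costSeq r h p I') :
    ∃ w : ℕ → List (Fin r),
      (∀ i ∈ Finset.Icc 1 N, ∀ j ∈ Finset.Icc 1 N, i ≠ j → ¬ w i <+: w j) ∧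
      (∀ i ∈ Finset.Icc 1 N, (w i).length ≤ h) ∧
      ∑ i ∈ Finset.Icc 1 N, ENNReal.ofReal (p i) * ((w i).length : ℝ≥0∞) =
        costSeq r h p I := by
  obtain ⟨⟨t, ht, hz, hinc, -⟩, hle⟩ := hI
  have hI0 : I 0 = 0 := hz 0 (Nat.zero_le _)
  have hup : ∀ k, k < h → I k ≤ I (k + 1) := by
    intro k hk
    rcases le_total t k with h1 | h1
    · exact (hinc k h1 hk).le
    · rw [hz k h1]; exact Nat.zero_le _
  let a : ℕ → ℕ := fun k => r * I (k + 1) - I k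
  have haN : ∀ k, k < h → a k ≤ N := by
    intro k hk
    have := hle (k + 1) (by omega) (by omega)
    simp only [Nat.add_sub_cancel] at this
    simp only [a]
    omega
  have ha : ∀ k, k < h → a k + I k = r * I (k + 1) := by
    intro k hk
    have := hup k hk
    have : I (k + 1) ≤ r * I (k + 1) := Nat.le_mul_of_pos_left _ (by omega)
    simp only [a]
    omega
  let K : ℕ → Finset ℕ := fun i => (Finset.range h).filter (fun k => i ≤ a k)
  have hfilt : ∀ k, k < h → (Finset.Icc 1 N).filter (fun i => i ≤ a k) = Finset.Icc 1 (a k) := by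
    intro k hk
    ext i
    have := haN k hk
    simp only [Finset.mem_filter, Finset.mem_Icc]
    omega
  have htel : ∀ m, m ≤ h → ∑ k ∈ Finset.range m, a k * r ^ k = I m * r ^ m := by
    intro m
    induction m with
    | zero => simp [hI0]
    | succ m ih =>
      intro hm
      rw [Finset.sum_range_succ, ih (by omega), pow_succ]
      have := ha m (by omega)
      calc I m * r ^ m + a m * r ^ m = (a m + I m) * r ^ m := by ring
        _ = _ := by rw [this]; ring
  have hn : (r - 1) * I h + 1 = N := by
    rw [hlast, Nat.mul_div_cancel' hdvd]; omega
  have hkraft : ∑ i ∈ Finset.Icc 1 N, r ^ (h - (K i).card) ≤ r ^ h := by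
    have h1 : ∑ i ∈ Finset.Icc 1 N, (r ^ (h - (K i).card) + (r - 1) * ∑ k ∈ K i, r ^ k)
        ≤ ∑ i ∈ Finset.Icc 1 N, r ^ h :=
      Finset.sum_le_sum fun i _ => kraft_aux r hr h (K i) (Finset.filter_subset _ _)
    have h2 : ∑ i ∈ Finset.Icc 1 N, ∑ k ∈ K i, r ^ k = I h * r ^ h := by
      rw [← htel h le_rfl]
      simp only [K, Finset.sum_filter]
      rw [Finset.sum_comm]
      refine Finset.sum_congr rfl fun k hk => ?_
      rw [← Finset.sum_filter, hfilt k (Finset.mem_range.1 hk)]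
      simp
    rw [Finset.sum_add_distrib, ← Finset.mul_sum, h2] at h1
    simp only [Finset.sum_const, Nat.card_Icc, Nat.add_sub_cancel, smul_eq_mul] at h1
    have h3 : N * r ^ h = (r - 1) * (I h * r ^ h) + r ^ h := by
      conv_lhs => rw [← hn]
      ring
    omega
  obtain ⟨w, hw1, hw2⟩ := kraft_code N r hr h (fun i => (K i).card)
    (fun i => by simpa using Finset.card_le_card (Finset.filter_subset (fun k => i ≤ a k) (Finset.range h)))
    (fun i j hij => Finset.card_le_card
      (Finset.monotone_filter_right _ fun k _ hk => le_trans hij hk)) hkraft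
  refine ⟨w, hw1, fun i _ => ?_, ?_⟩
  · rw [hw2]
    simpa using Finset.card_le_card (Finset.filter_subset (fun k => i ≤ a k) (Finset.range h))
  · have hc : costSeq r h p I = ∑ k ∈ Finset.range h, prefSum p (a k) := by
      unfold costSeq
      rw [Finset.range_eq_Ico]
      have e := Finset.sum_Ico_add' (fun k => prefSum p (r * I k - I (k - 1))) 0 h 1
      have e2 : Finset.Ico (0 + 1) (h + 1) = Finset.Icc 1 h := by
        ext x
        simp only [Finset.mem_Ico, Finset.mem_Icc]
        omega
      rw [e2] at e
      exact e.symm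
    rw [hc]
    have h1 : ∀ i ∈ Finset.Icc 1 N, ENNReal.ofReal (p i) * ((w i).length : ℝ≥0∞)
        = ∑ k ∈ Finset.range h, if i ≤ a k then ENNReal.ofReal (p i) else 0 := by
      intro i _
      rw [hw2, ← Finset.sum_filter, Finset.sum_const, nsmul_eq_mul, mul_comm]
    rw [Finset.sum_congr rfl h1, Finset.sum_comm]
    refine Finset.sum_congr rfl fun k hk => ?_
    have hk' := Finset.mem_range.1 hk
    rw [← Finset.sum_filter, hfilt k hk', prefSum, ENNReal.ofReal_sum_of_nonneg]
    intro i hi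
    simp only [Finset.mem_Icc] at hi
    exact (hpos i hi.1 (hi.2.trans (haN k hk'))).le
end

section
/- Let r ≥ 2, let n ≥ 2, and let p_1, ..., p_n be strictly positive real numbers. Then there exists a prefix-free code w of size n over an alphabet Σ with r letters whose cost is minimal among all prefix-free codes of size n over Σ, and which has at most one incomplete internal node; moreover, if such an incomplete node u exists, then |u| = h−1 where h = max_i |w_i| (i.e., u is at level 1), and at least two letters a ∈ Σ are such that u·a is a prefix of some codeword. -/
def S14PF {α : Type} (S : Finset ℕ) (w : ℕ → List α) : Prop :=
  ∀ i ∈ S, ∀ j ∈ S, i ≠ j → ¬ w i <+: w j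

theorem s14_replace {α : Type} (S : Finset ℕ) (w : ℕ → List α) (hw : S14PF S w)
    (u : List α) (b : α) (i : ℕ)
    (hu : ∃ k ∈ S, u <+: w k ∧ u ≠ w k) (hb : ∀ j ∈ S, ¬ (u ++ [b]) <+: w j) :
    S14PF S (Function.update w i (u ++ [b])) := by
  have key : ∀ j ∈ S, ¬ w j <+: (u ++ [b]) := by
    intro j hj h
    rcases List.prefix_concat_iff.1 h with h | h
    · exact hb j hj (by rw [h])
    · obtain ⟨k, hk, h1, h2⟩ := hu
      by_cases hjk : j = k
      · subst hjk
        exact h2 (h1.eq_of_length_le h.length_le)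
      · exact hw j hj k hk hjk (h.trans h1)
  intro j hj k hk hjk
  by_cases h1 : j = i
  · subst h1
    rw [Function.update_self, Function.update_of_ne (Ne.symm hjk)]
    exact hb k hk
  · rw [Function.update_of_ne h1]
    by_cases h2 : k = i
    · subst h2
      rw [Function.update_self]; exact key j hj
    · rw [Function.update_of_ne h2]; exact hw j hj k hk hjk

theorem s14_contract {α : Type} (S : Finset ℕ) (p : ℕ → ℝ) (hp : ∀ i ∈ S, 0 < p i)
    (w : ℕ → List α) (hw : S14PF S w)
    (u : List α) (a : α) (hu : ∃ k ∈ S, u <+: w k ∧ u ≠ w k)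
    (ha : ∀ b, (∃ j ∈ S, (u ++ [b]) <+: w j) → b = a) :
    ∃ w' : ℕ → List α, S14PF S w' ∧
      ∑ i ∈ S, p i * ((w' i).length : ℝ) < ∑ i ∈ S, p i * ((w i).length : ℝ) := by
  classical
  have key : ∀ j ∈ S, u <+: w j → ∃ t, w j = u ++ a :: t := by
    intro j hj h
    obtain ⟨k, hk, h1, h2⟩ := hu
    have hne : u ≠ w j := by
      by_cases hjk : j = k
      · subst hjk; exact h2
      · intro h3
        exact hw j hj k hk hjk (h3 ▸ h1)
    obtain ⟨s, hs⟩ := h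
    cases s with
    | nil => exact absurd (by simpa using hs) hne
    | cons c t =>
      have : c = a := ha c ⟨j, hj, t, by simp [← hs]⟩
      exact ⟨t, by rw [← hs, this]⟩
  let w' : ℕ → List α := fun j => if u <+: w j then u ++ (w j).drop (u.length + 1) else w j
  have h1 : ∀ j t, w j = u ++ a :: t → w' j = u ++ t := by
    intro j t h
    simp [w', h, List.drop_append]
  have h2 : ∀ j, ¬ u <+: w j → w' j = w j := by
    intro j h
    simp [w', h]
  refine ⟨w', ?_, ?_⟩
  · intro i hi j hj hij h
    by_cases hui : u <+: w i
    · obtain ⟨t, ht⟩ := key i hi hui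
      rw [h1 i t ht] at h
      by_cases huj : u <+: w j
      · obtain ⟨s, hs⟩ := key j hj huj
        rw [h1 j s hs, List.prefix_append_right_inj] at h
        apply hw i hi j hj hij
        rw [ht, hs, List.prefix_append_right_inj]
        exact List.cons_prefix_cons.2 ⟨rfl, h⟩
      · rw [h2 j huj] at h
        exact huj ((List.prefix_append _ _).trans h)
    · rw [h2 i hui] at h
      by_cases huj : u <+: w j
      · obtain ⟨s, hs⟩ := key j hj huj
        rw [h1 j s hs] at h
        rcases List.prefix_or_prefix_of_prefix h (List.prefix_append u s) with h3 | h3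
        · exact hw i hi j hj hij (h3.trans huj)
        · exact hui h3
      · rw [h2 j huj] at h
        exact hw i hi j hj hij h
  · apply Finset.sum_lt_sum
    · intro i hi
      apply mul_le_mul_of_nonneg_left _ (hp i hi).le
      by_cases hui : u <+: w i
      · obtain ⟨t, ht⟩ := key i hi hui
        rw [h1 i t ht, ht]; simp
      · rw [h2 i hui]
    · obtain ⟨k, hk, h3, h4⟩ := hu
      refine ⟨k, hk, ?_⟩
      apply mul_lt_mul_of_pos_left _ (hp k hk)
      obtain ⟨t, ht⟩ := key k hk h3
      rw [h1 k t ht, ht]; simp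

theorem s14_exists_min {α : Type} (S : Finset ℕ) (p : ℕ → ℝ) (hp : ∀ i ∈ S, 0 < p i)
    (a b : α) (hab : a ≠ b) :
    ∃ w : ℕ → List α, S14PF S w ∧ ∀ w' : ℕ → List α, S14PF S w' →
      ∑ i ∈ S, p i * ((w i).length : ℝ) ≤ ∑ i ∈ S, p i * ((w' i).length : ℝ) := by
  let f : (S → ℕ) → ℝ := fun l => ∑ i : S, p i * (l i : ℝ)
  have hf : Monotone f := by
    intro l m h
    apply Finset.sum_le_sum
    intro i _
    apply mul_le_mul_of_nonneg_left _ (hp i i.2).le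
    exact_mod_cast h i
  let L : Set (S → ℕ) := {l | ∃ w : ℕ → List α, S14PF S w ∧ l = fun i : S => (w i).length}
  have hL : L.IsPWO := Set.isPWO_of_wellQuasiOrderedLE L
  have hfL : (f '' L).IsWF := (hL.image_of_monotone hf).isWF
  have hne : (f '' L).Nonempty := by
    refine ⟨_, _, ⟨fun i => List.replicate i a ++ [b], ?_, rfl⟩, rfl⟩
    intro i _ j _ hij h
    have h1 := h.length_le
    simp at h1
    have h2 := h.getElem (i := i) (by simp)
    have : i < j := by omega
    simp [List.getElem_append, this] at h2
    exact hab h2.symm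
  obtain ⟨l, ⟨w, hw, rfl⟩, hl⟩ := hfL.min_mem hne
  have conv : ∀ w : ℕ → List α, f (fun i : S => (w i).length) = ∑ i ∈ S, p i * ((w i).length : ℝ) := by
    intro w
    exact Finset.sum_coe_sort S (fun i => p i * ((w i).length : ℝ))
  refine ⟨w, hw, fun w' hw' => ?_⟩
  rw [← conv, ← conv, hl]
  exact hfL.min_le hne ⟨_, ⟨w', hw', rfl⟩, rfl⟩

theorem stmt_14 (r n : ℕ) (hr : 2 ≤ r) (hn : 2 ≤ n)
    (α : Type) [Fintype α] (hcard : Fintype.card α = r)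
    (p : ℕ → ℝ) (hpos : ∀ i, 1 ≤ i → i ≤ n → 0 < p i) :
    ∃ w : ℕ → List α,
      -- `w` is a prefix-free code of size `n`
      (∀ i ∈ Finset.Icc 1 n, ∀ j ∈ Finset.Icc 1 n, i ≠ j → ¬ w i <+: w j) ∧
      -- `w` has minimal cost among all prefix-free codes of size `n` over `α`
      (∀ w' : ℕ → List α,
        (∀ i ∈ Finset.Icc 1 n, ∀ j ∈ Finset.Icc 1 n, i ≠ j → ¬ w' i <+: w' j) →
        ∑ i ∈ Finset.Icc 1 n, p i * ((w i).length : ℝ) ≤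
          ∑ i ∈ Finset.Icc 1 n, p i * ((w' i).length : ℝ)) ∧
      -- at most one incomplete internal node
      (∀ u v : List α,
        (∃ i ∈ Finset.Icc 1 n, u <+: w i ∧ u ≠ w i) →
        (∃ i ∈ Finset.Icc 1 n, v <+: w i ∧ v ≠ w i) →
        ¬(∀ a : α, ∃ j ∈ Finset.Icc 1 n, (u ++ [a]) <+: w j) →
        ¬(∀ a : α, ∃ j ∈ Finset.Icc 1 n, (v ++ [a]) <+: w j) →
        u = v) ∧
      -- an incomplete internal node is at level 1 and has degree ≥ 2
      (∀ u : List α,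
        (∃ i ∈ Finset.Icc 1 n, u <+: w i ∧ u ≠ w i) →
        ¬(∀ a : α, ∃ j ∈ Finset.Icc 1 n, (u ++ [a]) <+: w j) →
        u.length = ((Finset.Icc 1 n).sup fun i => (w i).length) - 1 ∧
        ∃ a b : α, a ≠ b ∧ (∃ j ∈ Finset.Icc 1 n, (u ++ [a]) <+: w j) ∧
          ∃ j ∈ Finset.Icc 1 n, (u ++ [b]) <+: w j) := by
  classical
  have hp : ∀ i ∈ Finset.Icc 1 n, 0 < p i := fun i hi =>
    hpos i (Finset.mem_Icc.1 hi).1 (Finset.mem_Icc.1 hi).2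
  generalize Finset.Icc 1 n = S at hp ⊢
  have hlt : 1 < Fintype.card α := by omega
  obtain ⟨x, y, hxy⟩ := Fintype.exists_pair_of_one_lt_card hlt
  obtain ⟨enc, henc⟩ := exists_injective_nat (List α)
  let Opt : (ℕ → List α) → Prop := fun w => S14PF S w ∧ ∀ w' : ℕ → List α, S14PF S w' →
      ∑ i ∈ S, p i * ((w i).length : ℝ) ≤ ∑ i ∈ S, p i * ((w' i).length : ℝ)
  let Q : (ℕ → List α) → ℕ := fun w => ∑ i ∈ S, enc (w i).dropLast
  have hex : ∃ w, Opt w := s14_exists_min S p hp x y hxy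
  obtain ⟨w, hw, hmin⟩ : ∃ w, Opt w ∧ ∀ w', Opt w' → Q w ≤ Q w' := by
    have hne : (Q '' {w | Opt w}).Nonempty := hex.elim fun w h => ⟨_, w, h, rfl⟩
    obtain ⟨w, hw, hq⟩ := Nat.sInf_mem hne
    exact ⟨w, hw, fun w' hw' => hq ▸ Nat.sInf_le ⟨w', hw', rfl⟩⟩
  obtain ⟨hpf, hopt⟩ := hw
  set h := S.sup fun i => (w i).length with hh
  have hle : ∀ i ∈ S, (w i).length ≤ h := fun i hi =>
    Finset.le_sup (f := fun i => (w i).length) hi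
  -- cost of a replacement
  have hcost : ∀ i ∈ S, ∀ z : List α, z.length < (w i).length →
      ¬ S14PF S (Function.update w i z) := by
    intro i hi z hz hc
    have := hopt _ hc
    apply absurd this
    rw [not_le]
    apply Finset.sum_lt_sum
    · intro j hj
      apply mul_le_mul_of_nonneg_left _ (hp j hj).le
      by_cases hji : j = i
      · subst hji; simp; omega
      · simp [hji]
    · refine ⟨i, hi, ?_⟩
      apply mul_lt_mul_of_pos_left _ (hp i hi)
      simpa using hz
  have hlev : ∀ u : List α, (∃ i ∈ S, u <+: w i ∧ u ≠ w i) →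
      ¬(∀ a : α, ∃ j ∈ S, (u ++ [a]) <+: w j) → u.length + 1 = h := by
    intro u hu hinc
    push Not at hinc
    obtain ⟨b, hb⟩ := hinc
    have hrep := fun i => s14_replace S w hpf u b i hu hb
    obtain ⟨k, hk, h1, h2⟩ := hu
    have h3 : u.length < (w k).length := by
      by_contra hcon
      exact h2 (h1.eq_of_length_le (by omega))
    have h4 := hle k hk
    obtain ⟨m, hm, hmh⟩ := Finset.exists_mem_eq_sup S ⟨k, hk⟩ (fun i => (w i).length)
    by_contra hcon
    refine hcost m hm (u ++ [b]) ?_ (hrep m)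
    simp at hmh ⊢
    omega
  have huniq : ∀ u v : List α, (∃ i ∈ S, u <+: w i ∧ u ≠ w i) →
      (∃ i ∈ S, v <+: w i ∧ v ≠ w i) →
      ¬(∀ a : α, ∃ j ∈ S, (u ++ [a]) <+: w j) →
      ¬(∀ a : α, ∃ j ∈ S, (v ++ [a]) <+: w j) → ¬ enc u < enc v := by
    intro u v hu hv hiu hiv hlt
    have hlu := hlev u hu hiu
    have hlv := hlev v hv hiv
    push Not at hiu
    obtain ⟨b, hb⟩ := hiu
    obtain ⟨k, hk, ⟨s, hs⟩, h2⟩ := hv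
    have hlk := hle k hk
    have hvk : (w k).dropLast = v ∧ (w k).length = h := by
      rw [← hs] at hlk h2 ⊢
      match s with
      | [] => simp at h2
      | [c] => simp [hlv]
      | c :: d :: t => simp at hlk; omega
    have hrep := s14_replace S w hpf u b k hu hb
    have hO : Opt (Function.update w k (u ++ [b])) := by
      refine ⟨hrep, fun w' hw' => le_trans (le_of_eq ?_) (hopt w' hw')⟩
      apply Finset.sum_congr rfl
      intro j _
      by_cases hjk : j = k
      · subst hjk
        simp only [Function.update_self, List.length_append, List.length_singleton, hlu, hvk.2]
      · simp [hjk]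
    apply absurd (hmin _ hO)
    rw [not_le]
    apply Finset.sum_lt_sum
    · intro j _
      by_cases hjk : j = k
      · subst hjk; simp [hvk.1]; omega
      · simp [hjk]
    · exact ⟨k, hk, by simpa [hvk.1] using hlt⟩
  refine ⟨w, hpf, hopt, ?_, ?_⟩
  · intro u v hu hv hiu hiv
    apply henc
    have h1 := huniq u v hu hv hiu hiv
    have h2 := huniq v u hv hu hiv hiu
    omega
  · intro u hu hiu
    refine ⟨by have := hlev u hu hiu; omega, ?_⟩
    by_contra hcon
    obtain ⟨k, hk, ⟨s, hs⟩, h2⟩ := id hu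
    match s with
    | [] => exact h2 (by simpa using hs)
    | c :: t =>
      have hc : ∃ j ∈ S, (u ++ [c]) <+: w j := ⟨k, hk, t, by simp [← hs]⟩
      obtain ⟨w', hw', hlt'⟩ := s14_contract S p hp w hpf u c hu (by
        intro b hb
        by_contra hbc
        exact hcon ⟨b, c, hbc, hb, hc⟩)
      exact absurd (hopt w' hw') (not_le.2 hlt')
end

section
/- Let n ≥ 2 and let p_1, ..., p_n be strictly positive real numbers. Let w be a prefix-free code of size n over the two-letter alphabet {0,1} whose cost sum_{i=1}^n p_i·|w_i| is minimal among all prefix-free codes of size n over {0,1}. Then the associated code tree is complete: for every word u that is a proper prefix of some codeword, both u·0 and u·1 are prefixes (proper or improper) of codewords. -/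
theorem aux_sib (n : ℕ)
    (p : ℕ → ℝ) (hpos : ∀ i, 1 ≤ i → i ≤ n → 0 < p i)
    (w : ℕ → List Bool)
    (hpf : ∀ i ∈ Finset.Icc 1 n, ∀ j ∈ Finset.Icc 1 n, i ≠ j → ¬ w i <+: w j)
    (hopt : ∀ w' : ℕ → List Bool,
      (∀ i ∈ Finset.Icc 1 n, ∀ j ∈ Finset.Icc 1 n, i ≠ j → ¬ w' i <+: w' j) →
      ∑ i ∈ Finset.Icc 1 n, p i * ((w i).length : ℝ) ≤
        ∑ i ∈ Finset.Icc 1 n, p i * ((w' i).length : ℝ))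
    (u : List Bool) (b : Bool) (i₀ : ℕ) (hi₀ : i₀ ∈ Finset.Icc 1 n)
    (hu : (u ++ [b]) <+: w i₀) : ∃ j ∈ Finset.Icc 1 n, (u ++ [!b]) <+: w j := by
  classical
  by_contra hno
  push Not at hno
  have hout : ∀ k ∈ Finset.Icc 1 n, ¬ (u ++ [b]) <+: w k → ¬ u <+: w k := by
    intro k hk hkb hku
    obtain ⟨t, ht⟩ := hku
    cases t with
    | nil =>
      refine hpf k hk i₀ hi₀ (fun h => hkb (h ▸ hu)) ?_
      rw [← ht, List.append_nil]
      exact (List.prefix_append u [b]).trans hu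
    | cons c t =>
      by_cases hc : c = b
      · exact hkb ⟨t, by rw [← ht, hc]; simp⟩
      · have hc' : c = !b := by cases c <;> cases b <;> simp_all
        exact hno k hk ⟨t, by rw [← ht, hc']; simp⟩
  let w' : ℕ → List Bool := fun k =>
    if (u ++ [b]) <+: w k then u ++ (w k).drop (u.length + 1) else w k
  have hin : ∀ k, (u ++ [b]) <+: w k → ∃ t, w k = u ++ b :: t ∧ w' k = u ++ t := by
    intro k hk
    have hk' := hk
    obtain ⟨t, ht⟩ := hk
    refine ⟨t, by rw [← ht]; simp, ?_⟩
    simp only [w', if_pos hk']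
    rw [← ht]
    congr 1
    have : u.length + 1 = (u ++ [b]).length := by simp
    rw [this, List.drop_left]
  have hnin : ∀ k, ¬ (u ++ [b]) <+: w k → w' k = w k := by
    intro k hk
    simp only [w', if_neg hk]
  have hlt : ∑ i ∈ Finset.Icc 1 n, p i * ((w' i).length : ℝ) <
      ∑ i ∈ Finset.Icc 1 n, p i * ((w i).length : ℝ) := by
    apply Finset.sum_lt_sum
    · intro k hk
      have hp := hpos k (Finset.mem_Icc.1 hk).1 (Finset.mem_Icc.1 hk).2
      by_cases h : (u ++ [b]) <+: w k
      · obtain ⟨t, h1, h2⟩ := hin k h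
        apply mul_le_mul_of_nonneg_left _ hp.le
        rw [h1, h2]; simp
      · rw [hnin k h]
    · refine ⟨i₀, hi₀, ?_⟩
      have hp := hpos i₀ (Finset.mem_Icc.1 hi₀).1 (Finset.mem_Icc.1 hi₀).2
      obtain ⟨t, h1, h2⟩ := hin i₀ hu
      apply mul_lt_mul_of_pos_left _ hp
      rw [h1, h2]; simp
  refine absurd (hopt w' ?_) (not_le.2 hlt)
  intro i hi j hj hij hpre
  by_cases h1 : (u ++ [b]) <+: w i <;> by_cases h2 : (u ++ [b]) <+: w j
  · obtain ⟨s, a1, a2⟩ := hin i h1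
    obtain ⟨t, b1, b2⟩ := hin j h2
    rw [a2, b2, List.prefix_append_right_inj] at hpre
    apply hpf i hi j hj hij
    rw [a1, b1, List.prefix_append_right_inj]
    exact (List.prefix_cons_inj b).2 hpre
  · obtain ⟨s, a1, a2⟩ := hin i h1
    rw [a2, hnin j h2] at hpre
    exact hout j hj h2 ((List.prefix_append u s).trans hpre)
  · obtain ⟨t, b1, b2⟩ := hin j h2
    rw [b2, hnin i h1] at hpre
    rcases List.prefix_or_prefix_of_prefix hpre (List.prefix_append u t) with h | h
    · apply hpf i hi j hj hij
      rw [b1]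
      exact h.trans (List.prefix_append u _)
    · exact hout i hi h1 h
  · rw [hnin i h1, hnin j h2] at hpre
    exact hpf i hi j hj hij hpre

theorem stmt_15 (n : ℕ) (hn : 2 ≤ n)
    (p : ℕ → ℝ) (hpos : ∀ i, 1 ≤ i → i ≤ n → 0 < p i)
    (w : ℕ → List Bool)
    (hpf : ∀ i ∈ Finset.Icc 1 n, ∀ j ∈ Finset.Icc 1 n, i ≠ j → ¬ w i <+: w j)
    (hopt : ∀ w' : ℕ → List Bool,
      (∀ i ∈ Finset.Icc 1 n, ∀ j ∈ Finset.Icc 1 n, i ≠ j → ¬ w' i <+: w' j) →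
      ∑ i ∈ Finset.Icc 1 n, p i * ((w i).length : ℝ) ≤
        ∑ i ∈ Finset.Icc 1 n, p i * ((w' i).length : ℝ)) :
    ∀ u : List Bool, (∃ i ∈ Finset.Icc 1 n, u <+: w i ∧ u ≠ w i) →
      (∃ j ∈ Finset.Icc 1 n, (u ++ [false]) <+: w j) ∧
      ∃ j ∈ Finset.Icc 1 n, (u ++ [true]) <+: w j := by
  rintro u ⟨i, hi, ⟨t, ht⟩, hne⟩
  cases t with
  | nil => exact absurd (by simpa using ht) hne
  | cons c t =>
    have hc : (u ++ [c]) <+: w i := ⟨t, by rw [← ht]; simp⟩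
    have hs := aux_sib n p hpos w hpf hopt u c i hi hc
    cases c
    · exact ⟨⟨i, hi, hc⟩, hs⟩
    · exact ⟨hs, ⟨i, hi, hc⟩⟩
end

section
/- Let n ≥ 1 and let p_1 ≥ p_2 ≥ ... ≥ p_n be nonnegative real numbers. Fix an integer d ≥ 1 and define c_{i,j} ∈ [0,∞] for 0 ≤ i, j ≤ n by: c_{i,j} = i·(p_{j+1} + p_{j+2} + ... + p_i) if d−1 ≤ j < i, and c_{i,j} = ∞ otherwise. Then c satisfies the Monge property: c_{i,j} + c_{i+1,j+1} ≤ c_{i+1,j} + c_{i,j+1} for all 0 ≤ i, j ≤ n−1. -/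
open scoped ENNReal

/-- The cost family of the wireless-paging DP (for paging round `d`):
`c_{i,j} = i·(p_{j+1} + ⋯ + p_i)` if `d-1 ≤ j < i`, and `∞` otherwise. -/
noncomputable def pagingC (d : ℕ) (p : ℕ → ℝ) (i j : ℕ) : ℝ≥0∞ :=
  if d - 1 ≤ j ∧ j < i then ENNReal.ofReal ((i : ℝ) * ∑ l ∈ Finset.Icc (j + 1) i, p l)
  else ⊤

theorem stmt_18 (n : ℕ) (hn : 1 ≤ n) (p : ℕ → ℝ)
    (hnonneg : ∀ i, 1 ≤ i → i ≤ n → 0 ≤ p i)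
    (hanti : ∀ i j, 1 ≤ i → i ≤ j → j ≤ n → p j ≤ p i)
    (d : ℕ) (hd : 1 ≤ d) :
    ∀ i j : ℕ, i ≤ n - 1 → j ≤ n - 1 →
      pagingC d p i j + pagingC d p (i + 1) (j + 1) ≤
        pagingC d p (i + 1) j + pagingC d p i (j + 1) := by
  intro i j hi hj
  by_cases h : d - 1 ≤ j ∧ j + 1 < i
  · obtain ⟨h1, h2⟩ := h
    have hS : 0 ≤ ∑ l ∈ Finset.Icc (j + 2) i, p l :=
      Finset.sum_nonneg fun l hl => by
        rw [Finset.mem_Icc] at hl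
        exact hnonneg l (by omega) (by omega)
    have hj1 : 0 ≤ p (j + 1) := hnonneg _ (by omega) (by omega)
    have hi1 : 0 ≤ p (i + 1) := hnonneg _ (by omega) (by omega)
    have e1 : ∑ l ∈ Finset.Icc (j + 1) i, p l = p (j + 1) + ∑ l ∈ Finset.Icc (j + 2) i, p l := by
      rw [← Finset.add_sum_Ioc_eq_sum_Icc (by omega : j + 1 ≤ i)]
      congr 2
      ext x
      simp only [Finset.mem_Ioc, Finset.mem_Icc]
      omega
    have e2 : ∑ l ∈ Finset.Icc (j + 1) (i + 1), p l
        = p (j + 1) + ∑ l ∈ Finset.Icc (j + 2) i, p l + p (i + 1) := by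
      rw [Finset.sum_Icc_succ_top (by omega), e1]
    have e3 : ∑ l ∈ Finset.Icc (j + 2) (i + 1), p l
        = ∑ l ∈ Finset.Icc (j + 2) i, p l + p (i + 1) := by
      rw [Finset.sum_Icc_succ_top (by omega)]
    unfold pagingC
    rw [if_pos (by omega), if_pos (by omega), if_pos (by omega), if_pos (by omega)]
    rw [show j + 1 + 1 = j + 2 from rfl, e1, e2, e3]
    generalize ∑ l ∈ Finset.Icc (j + 2) i, p l = S at *
    rw [← ENNReal.ofReal_add (by positivity) (by positivity),
      ← ENNReal.ofReal_add (by positivity) (by positivity)]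
    apply ENNReal.ofReal_le_ofReal
    push_cast
    nlinarith
  · have : pagingC d p (i + 1) j + pagingC d p i (j + 1) = ⊤ := by
      by_cases h1 : d - 1 ≤ j
      · have : pagingC d p i (j + 1) = ⊤ := if_neg (by omega)
        rw [this, add_top]
      · have : pagingC d p (i + 1) j = ⊤ := if_neg (by omega)
        rw [this, top_add]
    rw [this]
    exact le_top
end

section
/- Let n ≥ 2, let 0 < v_1 < v_2 < ... < v_{n−1} be real numbers, and let w_1, ..., w_{n−1} be nonnegative real numbers. Define c_{i,j} ∈ [0,∞] for 0 ≤ i, j ≤ n−1 by: c_{i,j} = sum_{l=j+1}^{i} w_l·(v_l − v_{j+1}) if j ≤ i (with the empty sum equal to 0 when j = i), and c_{i,j} = ∞ if j > i. Then c satisfies the Monge property: c_{i,j} + c_{i+1,j+1} ≤ c_{i+1,j} + c_{i,j+1} for all 0 ≤ i, j ≤ n−2. -/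
open scoped ENNReal

/-- The cost family of the `D`-medians-on-a-line DP:
`c_{i,j} = ∑_{l=j+1}^{i} w_l·(v_l − v_{j+1})` if `j ≤ i` (empty sum `0` when `j = i`),
and `∞` if `j > i`. -/
noncomputable def medianC (v w : ℕ → ℝ) (i j : ℕ) : ℝ≥0∞ :=
  if j ≤ i then ENNReal.ofReal (∑ l ∈ Finset.Icc (j + 1) i, w l * (v l - v (j + 1)))
  else ⊤

theorem stmt_19 (n : ℕ) (hn : 2 ≤ n) (v w : ℕ → ℝ)
    (hvpos : ∀ l, 1 ≤ l → l ≤ n - 1 → 0 < v l)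
    (hvmono : ∀ l m, 1 ≤ l → l < m → m ≤ n - 1 → v l < v m)
    (hwnonneg : ∀ l, 1 ≤ l → l ≤ n - 1 → 0 ≤ w l) :
    ∀ i j : ℕ, i ≤ n - 2 → j ≤ n - 2 →
      medianC v w i j + medianC v w (i + 1) (j + 1) ≤
        medianC v w (i + 1) j + medianC v w i (j + 1) := by
  intro i j hi hj
  by_cases h : j + 1 ≤ i
  · have key : ∀ k, k ≤ i → 0 ≤ ∑ l ∈ Finset.Icc (k + 1) i, w l * (v l - v (k + 1)) := by
      intro k hk
      apply Finset.sum_nonneg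
      intro l hl
      rw [Finset.mem_Icc] at hl
      apply mul_nonneg (hwnonneg l (by omega) (by omega))
      rcases Nat.eq_or_lt_of_le hl.1 with e | e
      · rw [e]; simp
      · exact sub_nonneg.2 (hvmono _ _ (by omega) e (by omega)).le
    have key2 : ∀ k, k + 1 ≤ i + 1 →
        0 ≤ w (i + 1) * (v (i + 1) - v (k + 1)) := by
      intro k hk
      apply mul_nonneg (hwnonneg _ (by omega) (by omega))
      rcases Nat.eq_or_lt_of_le hk with e | e
      · rw [e]; simp
      · exact sub_nonneg.2 (hvmono _ _ (by omega) e (by omega)).le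
    have a1 := key j (by omega)
    have a2 := key (j + 1) h
    have b1 := key2 j (by omega)
    have b2 := key2 (j + 1) (by omega)
    have hm : w (i + 1) * (v (i + 1) - v (j + 1 + 1)) ≤ w (i + 1) * (v (i + 1) - v (j + 1)) := by
      apply mul_le_mul_of_nonneg_left _ (hwnonneg _ (by omega) (by omega))
      have := hvmono (j + 1) (j + 1 + 1) (by omega) (by omega) (by omega)
      linarith
    unfold medianC
    rw [if_pos (by omega), if_pos (by omega), if_pos (by omega), if_pos h,
      Finset.sum_Icc_succ_top (by omega), Finset.sum_Icc_succ_top (by omega),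
      ← ENNReal.ofReal_add a1 (add_nonneg a2 b2), ← ENNReal.ofReal_add (add_nonneg a1 b1) a2]
    apply ENNReal.ofReal_le_ofReal
    linarith
  · have : medianC v w i (j + 1) = ⊤ := by
      unfold medianC
      rw [if_neg h]
    rw [this, add_top]
    exact le_top
end
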